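/- Let n ≥ 3 and 0 ≤ r ≤ n−2 be integers, let G be any n-dimensional hypercube-like network (G ∈ HL_n), and let S be any set of edges of G with |S| ≤ 2^r·(n−r) − 1. Then the graph G − S has a connected component C with at least 2^n − (2^r − 1) vertices. -/

import Mathlib

/-- `IsHL n G` : `G` is an `n`-dimensional hypercube-like network (`G ∈ HL_n`).
`HL_0 = {K_1}`, and `G ∈ HL_n` iff the vertex set can be partitioned into `S` and `Sᶜ`
with both induced subgraphs in `HL_{n-1}` and the edges between `S` and `Sᶜ`
forming a perfect matching between them. -/
def IsHL : (n : ℕ) → {V : Type} → [Fintype V] → [DecidableEq V] → SimpleGraph V → Prop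
  | 0, V, _, _, _ => Fintype.card V = 1
  | n + 1, _, _, _, G =>
      ∃ S : Finset _,
        IsHL n (G.induce (S : Set _)) ∧
        IsHL n (G.induce ((Sᶜ : Finset _) : Set _)) ∧
        (∀ v ∈ S, ∃! w, w ∉ S ∧ G.Adj v w) ∧
        (∀ v ∉ S, ∃! w, w ∈ S ∧ G.Adj v w)

open Classical in
/-- The ordered pairs `(u, v)` of adjacent vertices with `u ∈ A` and `v ∉ A`. -/
noncomputable def edgeBoundary {V : Type} [Fintype V] (G : SimpleGraph V) (A : Finset V) :
    Finset (V × V) :=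
  Finset.univ.filter fun p => p.1 ∈ A ∧ p.2 ∉ A ∧ G.Adj p.1 p.2

lemma mem_edgeBoundary {V : Type} [Fintype V] {G : SimpleGraph V} {A : Finset V} {p : V × V} :
    p ∈ edgeBoundary G A ↔ p.1 ∈ A ∧ p.2 ∉ A ∧ G.Adj p.1 p.2 := by
  simp [edgeBoundary]

/-- Superadditivity of `x log x` with the binary-entropy gain. -/
lemma mul_log_add_le {x y : ℝ} (hy : 0 ≤ y) (hxy : y ≤ x) :
    x * Real.log x + y * Real.log y + 2 * y * Real.log 2 ≤ (x + y) * Real.log (x + y) := by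
  rcases hy.eq_or_lt with rfl | hy
  · simp
  have hx : 0 < x := hy.trans_le hxy
  have ht : 0 ≤ y / x := by positivity
  have ht1 : 0 ≤ 1 - y / x := by rw [sub_nonneg, div_le_one hx]; exact hxy
  have h1 := Real.convexOn_mul_log.2 (Set.mem_Ici.2 hy.le)
    (Set.mem_Ici.2 (add_pos hx hy).le) ht ht1 (by ring)
  have h2 := Real.convexOn_mul_log.2 (Set.mem_Ici.2 hy.le)
    (Set.mem_Ici.2 (add_pos hx hy).le) ht1 ht (by ring)
  simp only [smul_eq_mul] at h1 h2
  have e1 : y / x * y + (1 - y / x) * (x + y) = x := by field_simp; ring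
  have e2 : (1 - y / x) * y + y / x * (x + y) = 2 * y := by field_simp; ring
  rw [e1] at h1
  rw [e2, Real.log_mul two_ne_zero hy.ne'] at h2
  linarith

/-- On `[2 ^ r, 2 ^ (n - 1)]`, the function `a (n - log₂ a)` is at least `2 ^ r (n - r)`. -/
lemma two_pow_mul_log_le {m r : ℕ} (hr : r < m) {a : ℝ} (h1 : 2 ^ r ≤ a) (h2 : a ≤ 2 ^ m) :
    2 ^ r * ((m + 1 : ℝ) - r) * Real.log 2 ≤ a * ((m + 1 : ℝ) * Real.log 2) - a * Real.log a := by
  have hconv : ConvexOn ℝ (Set.Ici 0)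
      (fun x : ℝ => x * Real.log x + (-((m + 1 : ℝ) * Real.log 2)) * x) := by
    refine Real.convexOn_mul_log.add ⟨convex_Ici 0, ?_⟩
    intros
    simp only [smul_eq_mul]
    exact le_of_eq (by ring)
  have h := hconv.le_max_of_mem_Icc (x := 2 ^ r) (y := 2 ^ m) (z := a)
    (Set.mem_Ici.2 (by positivity)) (Set.mem_Ici.2 (by positivity)) ⟨h1, h2⟩
  simp only [Real.log_pow] at h
  have hl : 0 < Real.log 2 := Real.log_pos one_lt_two
  have key : (2 : ℝ) ^ r * ((m + 1 : ℝ) - r) ≤ 2 ^ m := by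
    obtain ⟨k, rfl⟩ := Nat.exists_eq_add_of_lt hr
    have hk : ((k + 1 + 1 : ℕ) : ℝ) ≤ 2 ^ (k + 1) := by
      exact_mod_cast Nat.lt_two_pow_self (n := k + 1)
    have : (2 : ℝ) ^ (r + k + 1) = 2 ^ r * 2 ^ (k + 1) := by ring
    rw [this]
    refine mul_le_mul_of_nonneg_left ?_ (by positivity)
    push_cast at hk ⊢
    linarith
  have key' := mul_le_mul_of_nonneg_right key hl.le
  rcases le_max_iff.1 h with h | h
  · linarith
  · linarith

/-- A perfect matching from `S` to its complement contributes to the boundary of `A` at least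
the surplus of `A` on `S`. -/
lemma card_le_card_add_card_cross {V : Type} [Fintype V] [DecidableEq V] (G : SimpleGraph V)
    (A S : Finset V) (h1 : ∀ v ∈ S, ∃! w, w ∉ S ∧ G.Adj v w)
    (h2 : ∀ v ∉ S, ∃! w, w ∈ S ∧ G.Adj v w) :
    (A.filter (· ∈ S)).card ≤ (A.filter (· ∉ S)).card +
      ((edgeBoundary G A).filter fun p => p.1 ∈ S ∧ p.2 ∉ S).card := by
  choose! f hf using fun v hv => (h1 v hv).exists
  have hinj : ∀ u ∈ S, ∀ v ∈ S, f u = f v → u = v := fun u hu v hv huv =>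
    (h2 (f u) (hf u hu).1).unique ⟨hu, (hf u hu).2.symm⟩ ⟨hv, huv ▸ (hf v hv).2.symm⟩
  rw [← Finset.card_filter_add_card_filter_not (s := A.filter (· ∈ S)) (fun v => f v ∈ A)]
  refine add_le_add (Finset.card_le_card_of_injOn f ?_ ?_)
    (Finset.card_le_card_of_injOn (fun v => (v, f v)) ?_ ?_)
  · intro v hv
    simp only [Finset.coe_filter, Finset.mem_filter, Set.mem_ofPred_eq] at hv ⊢
    exact ⟨hv.2, (hf v hv.1.2).1⟩
  · intro u hu v hv
    simp only [Finset.coe_filter, Finset.mem_filter, Set.mem_ofPred_eq] at hu hv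
    exact hinj u hu.1.2 v hv.1.2
  · intro v hv
    simp only [Finset.coe_filter, Finset.mem_filter, Set.mem_ofPred_eq, mem_edgeBoundary] at hv ⊢
    exact ⟨⟨hv.1.1, hv.2, (hf v hv.1.2).2⟩, hv.1.2, (hf v hv.1.2).1⟩
  · intro u _ v _ huv
    exact congrArg Prod.fst huv

/-- The boundary inside an induced subgraph is the part of the boundary inside the vertex set. -/
lemma card_edgeBoundary_induce_le {V : Type} [Fintype V] [DecidableEq V] (G : SimpleGraph V)
    (A S : Finset V) :
    (edgeBoundary (G.induce (S : Set V)) (Finset.univ.filter fun v => v.1 ∈ A)).card ≤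
      ((edgeBoundary G A).filter fun p => p.1 ∈ S ∧ p.2 ∈ S).card := by
  refine Finset.card_le_card_of_injOn (fun p => (p.1.1, p.2.1)) ?_ ?_
  · rintro ⟨⟨u, hu⟩, ⟨v, hv⟩⟩ hp
    have hp := mem_edgeBoundary.1 (Finset.mem_coe.1 hp)
    simp only [Finset.mem_filter, Finset.mem_univ, true_and, SimpleGraph.comap_adj,
      Function.Embedding.subtype_apply] at hp
    simp only [Finset.coe_filter, Set.mem_ofPred_eq, mem_edgeBoundary]
    exact ⟨hp, hu, hv⟩
  · intro p _ q _ h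
    simp only [Prod.mk.injEq] at h
    exact Prod.ext (Subtype.ext h.1) (Subtype.ext h.2)

lemma card_filter_subtype_mem {V : Type} [Fintype V] [DecidableEq V] (A S : Finset V) :
    (Finset.univ.filter fun v : (S : Set V) => v.1 ∈ A).card = (A.filter (· ∈ S)).card := by
  refine Finset.card_bij (fun v _ => v.1) ?_ ?_ ?_
  · rintro ⟨v, hv⟩ h
    simpa using ⟨by simpa using h, hv⟩
  · intro u _ v _ h
    exact Subtype.ext h
  · intro v hv
    rw [Finset.mem_filter] at hv
    exact ⟨⟨v, hv.2⟩, by simpa using hv.1, rfl⟩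

lemma IsHL.card_eq {n : ℕ} {V : Type} [Fintype V] [DecidableEq V] {G : SimpleGraph V}
    (h : IsHL n G) : Fintype.card V = 2 ^ n := by
  induction n generalizing V with
  | zero => exact h
  | succ n ih =>
    obtain ⟨S, h0, h1, -, -⟩ := h
    have e0 := ih h0
    have e1 := ih h1
    have c0 : Fintype.card (S : Set V) = S.card := by simp
    have c1 : Fintype.card ((Sᶜ : Finset V) : Set V) = Sᶜ.card := by
      rw [← Nat.card_eq_fintype_card, Nat.card_coe_set_eq, Set.ncard_coe_finset]
    rw [c0] at e0
    rw [c1] at e1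
    rw [← Finset.card_add_card_compl S, e0, e1, pow_succ]
    ring

/-- Edge-isoperimetric inequality for hypercube-like networks. -/
lemma IsHL.isoperimetric {n : ℕ} {V : Type} [Fintype V] [DecidableEq V] {G : SimpleGraph V}
    (h : IsHL n G) (A : Finset V) :
    (A.card : ℝ) * (n * Real.log 2) - A.card * Real.log A.card ≤
      (edgeBoundary G A).card * Real.log 2 := by
  have hl : 0 < Real.log 2 := Real.log_pos one_lt_two
  induction n generalizing V with
  | zero =>
    have hc : A.card ≤ 1 := (Finset.card_le_univ A).trans h.card_eq.le
    have : 0 ≤ ((edgeBoundary G A).card : ℝ) * Real.log 2 := by positivity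
    interval_cases A.card <;> simpa using this
  | succ n ih =>
    obtain ⟨S, h0, h1, m0, m1⟩ := h
    have b0 := ih h0 (Finset.univ.filter fun v => v.1 ∈ A)
    have b1 := ih h1 (Finset.univ.filter fun v => v.1 ∈ A)
    rw [card_filter_subtype_mem] at b0 b1
    have i0 := card_edgeBoundary_induce_le G A S
    have i1 := card_edgeBoundary_induce_le G A Sᶜ
    have x0 := card_le_card_add_card_cross G A S m0 m1
    have x1 := card_le_card_add_card_cross G A Sᶜ
      (by simpa using m1) (by simpa using m0)
    simp only [Finset.mem_compl, not_not] at b1 i1 x1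
    have hA : (A.filter (· ∈ S)).card + (A.filter (· ∉ S)).card = A.card :=
      Finset.card_filter_add_card_filter_not _
    have hB : ((edgeBoundary G A).filter fun p => p.1 ∈ S ∧ p.2 ∈ S).card +
        ((edgeBoundary G A).filter fun p => p.1 ∉ S ∧ p.2 ∉ S).card +
        ((edgeBoundary G A).filter fun p => p.1 ∈ S ∧ p.2 ∉ S).card +
        ((edgeBoundary G A).filter fun p => p.1 ∉ S ∧ p.2 ∈ S).card =
        (edgeBoundary G A).card := by
      rw [← Finset.card_filter_add_card_filter_not (s := edgeBoundary G A) (fun p => p.1 ∈ S),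
        ← Finset.card_filter_add_card_filter_not
          (s := (edgeBoundary G A).filter fun p => p.1 ∈ S) (fun p => p.2 ∈ S),
        ← Finset.card_filter_add_card_filter_not
          (s := (edgeBoundary G A).filter fun p => p.1 ∉ S) (fun p => p.2 ∈ S)]
      simp only [Finset.filter_filter]
      ring
    set a0 := (A.filter (· ∈ S)).card
    set a1 := (A.filter (· ∉ S)).card
    set c0 := (edgeBoundary (G.induce (S : Set V)) (Finset.univ.filter fun v => v.1 ∈ A)).card
    set c1 := (edgeBoundary (G.induce ((Sᶜ : Finset V) : Set V))
      (Finset.univ.filter fun v => v.1 ∈ A)).card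
    set c := (edgeBoundary G A).card
    have k0 : (c0 + c1 + a0 : ℝ) ≤ c + a1 := by
      have : c0 + c1 + a0 ≤ c + a1 := by omega
      exact_mod_cast this
    have k1 : (c0 + c1 + a1 : ℝ) ≤ c + a0 := by
      have : c0 + c1 + a1 ≤ c + a0 := by omega
      exact_mod_cast this
    have l0 := mul_le_mul_of_nonneg_right k0 hl.le
    have l1 := mul_le_mul_of_nonneg_right k1 hl.le
    rw [← hA]
    push_cast
    rcases le_total a0 a1 with hle | hle
    · have := mul_log_add_le (Nat.cast_nonneg (α := ℝ) a0) (Nat.cast_le.2 hle)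
      rw [add_comm (a1 : ℝ)] at this
      linarith
    · have := mul_log_add_le (Nat.cast_nonneg (α := ℝ) a1) (Nat.cast_le.2 hle)
      linarith

/-- Edges of the boundary of a set that no edge of `G - S` leaves all belong to `S`. -/
lemma card_edgeBoundary_le_ncard {V : Type} [Fintype V] (G : SimpleGraph V) (S : Set (Sym2 V))
    (A : Finset V) (hA : ∀ u v, (G.deleteEdges S).Adj u v → (u ∈ A ↔ v ∈ A)) :
    (edgeBoundary G A).card ≤ S.ncard := by
  rw [← Set.ncard_coe_finset]
  refine Set.ncard_le_ncard_of_injOn (fun p => s(p.1, p.2)) ?_ ?_ S.toFinite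
  · intro p hp
    have hp := mem_edgeBoundary.1 (Finset.mem_coe.1 hp)
    by_contra hS
    exact hp.2.1 ((hA p.1 p.2 (SimpleGraph.deleteEdges_adj.2 ⟨hp.2.2, hS⟩)).1 hp.1)
  · intro p hp q hq h
    have hp := mem_edgeBoundary.1 (Finset.mem_coe.1 hp)
    have hq := mem_edgeBoundary.1 (Finset.mem_coe.1 hq)
    rcases Sym2.eq_iff.1 h with h | h
    · exact Prod.ext h.1 h.2
    · exact absurd (h.1 ▸ hp.1) hq.2.1

lemma IsHL.two_pow_mul_le_ncard {m r : ℕ} (hr : r < m) {V : Type} [Fintype V] [DecidableEq V]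
    {G : SimpleGraph V} (hG : IsHL (m + 1) G) (S : Set (Sym2 V)) (A : Finset V)
    (hA : ∀ u v, (G.deleteEdges S).Adj u v → (u ∈ A ↔ v ∈ A))
    (h1 : 2 ^ r ≤ A.card) (h2 : A.card + 2 ^ r ≤ 2 ^ (m + 1)) :
    (2 : ℤ) ^ r * (((m + 1 : ℕ) : ℤ) - r) ≤ S.ncard := by
  wlog hle : A.card ≤ 2 ^ m generalizing A
  · have hc := Finset.card_add_card_compl A
    rw [hG.card_eq] at hc
    refine this Aᶜ (fun u v huv => ?_) (by omega) (by omega) ?_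
    · simp [hA u v huv]
    · rw [pow_succ] at hc
      omega
  have h := hG.isoperimetric A
  have h' := two_pow_mul_log_le hr (a := A.card) (by exact_mod_cast h1) (by exact_mod_cast hle)
  push_cast at h
  have hl : 0 < Real.log 2 := Real.log_pos one_lt_two
  have h3 := le_of_mul_le_mul_right (h'.trans h) hl
  have h4 : ((edgeBoundary G A).card : ℝ) ≤ S.ncard := by
    exact_mod_cast card_edgeBoundary_le_ncard G S A hA
  have h5 := h3.trans h4
  exact_mod_cast h5

/-- Lemma 2.7: if `G ∈ HL_n` and `|S| ≤ 2^r (n - r) - 1`, then `G - S` has a connected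
component with at least `2^n - (2^r - 1)` vertices, where `n ≥ 3` and `0 ≤ r ≤ n - 2`. -/
theorem exists_big_component_HL
    {n r : ℕ} (hn : 3 ≤ n) (hr : r + 2 ≤ n)
    {V : Type} [Fintype V] [DecidableEq V] (G : SimpleGraph V) (hG : IsHL n G)
    (S : Set (Sym2 V)) (hSsub : S ⊆ G.edgeSet)
    (hScard : (S.ncard : ℤ) ≤ 2 ^ r * ((n : ℤ) - r) - 1) :
    ∃ C : (G.deleteEdges S).ConnectedComponent,
      (2 : ℤ) ^ n - (2 ^ r - 1) ≤ (C.supp.ncard : ℤ) := by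
  classical
  obtain ⟨m, rfl⟩ : ∃ m, n = m + 1 := ⟨n - 1, by omega⟩
  have hiso : ∀ A : Finset V, (∀ u v, (G.deleteEdges S).Adj u v → (u ∈ A ↔ v ∈ A)) →
      2 ^ r ≤ A.card → 2 ^ (m + 1) < A.card + 2 ^ r := by
    intro A hA h1
    by_contra! h2
    have := hG.two_pow_mul_le_ncard (by omega) S A hA h1 h2
    omega
  have hpow : 2 ^ r * 4 ≤ 2 ^ (m + 1) := by
    calc 2 ^ r * 4 = 2 ^ (r + 2) := by ring
      _ ≤ 2 ^ (m + 1) := Nat.pow_le_pow_right two_pos hr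
  have hpos : 0 < 2 ^ r := by positivity
  obtain ⟨A, hAmem, hAmin⟩ := Finset.exists_min_image
    (Finset.univ.filter fun A : Finset V =>
      (∀ u v, (G.deleteEdges S).Adj u v → (u ∈ A ↔ v ∈ A)) ∧ 2 ^ r ≤ A.card) Finset.card
    ⟨Finset.univ, by simp [hG.card_eq]; omega⟩
  simp only [Finset.mem_filter, Finset.mem_univ, true_and] at hAmem hAmin
  obtain ⟨hA, hcard⟩ := hAmem
  obtain ⟨v, hv⟩ : A.Nonempty := Finset.card_pos.1 (by omega)
  set c := (G.deleteEdges S).connectedComponentMk v with hc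
  set C : Finset V := c.supp.toFinset with hCdef
  have hC : ∀ u w, (G.deleteEdges S).Adj u w → (u ∈ C ↔ w ∈ C) := by
    intro u w huw
    simp only [hCdef, Set.mem_toFinset]
    exact c.mem_supp_congr_adj huw
  have hCA : C ⊆ A := by
    intro w hw
    rw [hCdef, Set.mem_toFinset, SimpleGraph.ConnectedComponent.mem_supp_iff, hc,
      SimpleGraph.ConnectedComponent.eq] at hw
    obtain ⟨p⟩ := hw
    have hwalk : ∀ {x y : V}, (G.deleteEdges S).Walk x y → y ∈ A → x ∈ A := by
      intro x y p hy
      induction p with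
      | nil => exact hy
      | cons huw _ ih => exact (hA _ _ huw).2 (ih hy)
    exact hwalk p hv
  have hvC : v ∈ C := by simp [hCdef, hc]
  have hCpos : 0 < C.card := Finset.card_pos.2 ⟨v, hvC⟩
  have hsd : (A \ C).card + C.card = A.card := Finset.card_sdiff_add_card_eq_card hCA
  have hbig : 2 ^ r ≤ C.card := by
    by_contra! hlt
    have h1 : (A \ C).card < 2 ^ r := by
      by_contra! h
      have := hAmin (A \ C) ⟨fun u w huw => by
        rw [Finset.mem_sdiff, Finset.mem_sdiff, hA u w huw, hC u w huw], h⟩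
      omega
    have := hiso A hA hcard
    omega
  refine ⟨c, ?_⟩
  have h := hiso C hC hbig
  have hn : c.supp.ncard = C.card := Set.ncard_eq_toFinset_card' _
  rw [hn]
  have h' : (2 : ℤ) ^ (m + 1) < C.card + 2 ^ r := by exact_mod_cast h
  linarith
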